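/- arXiv:math/0608287 — 2 statements merged into one kernel-verified Lean document; each statement's English description precedes it below -/
import Mathlib

section
/- Let L be a free ℤ-module of finite rank with a symmetric bilinear form · : L × L → ℤ, and let σ be an automorphism of L preserving · and satisfying σ² + σ + 1 = 0 in End(L). Write B_ℂ for the ℂ-bilinear extension of · to L ⊗ ℂ, and extend σ ℂ-linearly. For α ∈ L set α_ω := −(1/θ)·(ω·σ(α) − ω̄·σ²(α)) and β_{ω̄} := −(1/θ)·(−ω̄·σ(β) + ω·σ²(β)) in L ⊗ ℂ (these are the projections of α, β to the ω- and ω̄-eigenspaces of σ). Then for all α, β ∈ L one has 3·B_ℂ(α_ω, β_{ω̄}) = (1/2)·(3·(α·β) − θ·(α·(σ²β − σβ))); that is, the Hodge-theoretic Hermitian pairing of the eigenspace projections agrees with the Eisenstein Hermitian form on L. -/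
noncomputable section

/-- The primitive cube root of unity `ω = e^{2πi/3}`. -/
def ω : ℂ := ⟨-1/2, Real.sqrt 3 / 2⟩

/-- `θ = ω - ω̄`, a square root of `-3`. -/
def θ : ℂ := ω - (starRingEnd ℂ) ω

/-- `ω̄ = -1 - ω`. -/
lemma conj_ω : (starRingEnd ℂ) ω = -1 - ω := by
  apply Complex.ext <;> simp [ω]; norm_num

lemma ω_sq_add_ω_add_one : ω ^ 2 + ω + 1 = 0 := by
  have h : Real.sqrt 3 * Real.sqrt 3 = 3 := Real.mul_self_sqrt (by norm_num)
  apply Complex.ext <;> simp [ω, pow_two] <;> linarith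

lemma θ_sq : θ ^ 2 = -3 := by
  rw [θ, conj_ω]
  linear_combination 4 * ω_sq_add_ω_add_one

/-- For `L` free of finite rank over ℤ with symmetric bilinear form `dot`
preserved by `σ` with `σ² + σ + 1 = 0`, and `B` the ℂ-bilinear extension of `dot` to the
complexification `V` (via `ι : L → V`), with
`α_ω = −(1/θ)(ω·σα − ω̄·σ²α)` and `β_ω̄ = −(1/θ)(−ω̄·σβ + ω·σ²β)` the eigenspace
projections, one has `3·B(α_ω, β_ω̄) = (1/2)(3(α·β) − θ·(α·(σ²β − σβ)))`. -/
theorem stmt_1 (L : Type*) [AddCommGroup L] [Module ℤ L]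
    [Module.Free ℤ L] [Module.Finite ℤ L]
    (dot : L →ₗ[ℤ] L →ₗ[ℤ] ℤ)
    (hsymm : ∀ x y : L, dot x y = dot y x)
    (σ : L ≃ₗ[ℤ] L)
    (hpres : ∀ x y : L, dot (σ x) (σ y) = dot x y)
    (hσ : ∀ x : L, σ (σ x) + σ x + x = 0)
    (V : Type*) [AddCommGroup V] [Module ℂ V]
    (B : V →ₗ[ℂ] V →ₗ[ℂ] ℂ)
    (ι : L →ₗ[ℤ] V)
    (hB : ∀ x y : L, B (ι x) (ι y) = (dot x y : ℂ)) :
    ∀ α β : L,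
      3 * B (-(1/θ) • (ω • ι (σ α) - (starRingEnd ℂ) ω • ι (σ (σ α))))
            (-(1/θ) • (-((starRingEnd ℂ) ω) • ι (σ β) + ω • ι (σ (σ β))))
      = (1/2) * (3 * (dot α β : ℂ) - θ * (dot α (σ (σ β) - σ β) : ℂ)) := by
  intro α β
  have hθ : θ ≠ 0 := by
    intro h
    have := θ_sq
    norm_num [h] at this
  have hω : ω = (θ - 1) / 2 := by
    rw [θ, conj_ω]
    ring
  have hcube : ∀ x, σ (σ (σ x)) = x := by
    intro x
    have h := hσ (σ x)
    rw [← hσ x] at h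
    have h' : σ (σ (σ x)) + (σ (σ x) + σ x) = x + (σ (σ x) + σ x) := by
      rw [← add_assoc, h]
      abel
    exact add_right_cancel h'
  have hadj : dot (σ α) β = dot α (σ (σ β)) := by
    rw [← hpres α, hcube]
  have hsum : (dot α (σ (σ β)) : ℂ) = -dot α (σ β) - dot α β := by
    have h := congrArg (dot α) (hσ β)
    simp only [map_add, map_zero] at h
    have h' : dot α (σ (σ β)) = -dot α (σ β) - dot α β := by linarith
    exact_mod_cast h'
  simp only [map_smul, map_sub, map_add, LinearMap.smul_apply, LinearMap.sub_apply,
    smul_eq_mul, hB, hpres, hadj, Int.cast_sub, hsum]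
  have hinv : 1 / θ = -θ / 3 := by
    field_simp
    linear_combination θ_sq
  rw [hinv, conj_ω, hω]
  linear_combination ((dot α β : ℂ) * ((θ ^ 2 - 6) / 12 - θ / 6) - (dot α (σ β) : ℂ) * (θ / 3)) * θ_sq
end
end

section
/- Let E₈^ℰ be the ℰ-module ℰ⁴ with the Hermitian form ⟨x,y⟩ = Σ_{i,j} B_{ij} x_i conj(y_j), where B = [[3,θ,0,0],[−θ,3,θ,0],[0,−θ,3,θ],[0,0,−θ,3]]. On the underlying rank-8 free ℤ-module (with ℤ-basis e₁, ωe₁, e₂, ωe₂, e₃, ωe₃, e₄, ωe₄) define b(x,y) := (2/3)·Re⟨x,y⟩. Then b takes values in ℤ, b(x,x) ∈ 2ℤ for all x (b is even), b is positive definite, and the Gram matrix of b with respect to this ℤ-basis has determinant 1 (b is unimodular). -/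
noncomputable section

/-- The ring of Eisenstein integers `ℰ = ℤ[ω]` as a subring of ℂ. -/
def Eis : Subring ℂ := Subring.closure {ω}

/-- The Gram matrix of `E₈^ℰ`. -/
def Bmat : Matrix (Fin 4) (Fin 4) ℂ :=
  !![3, θ, 0, 0; -θ, 3, θ, 0; 0, -θ, 3, θ; 0, 0, -θ, 3]

/-- The Hermitian form `⟨x,y⟩ = Σ B_{ij} x_i conj(y_j)` on `ℂ⁴` (restricting to `E₈^ℰ = ℰ⁴`). -/
def hermB (x y : Fin 4 → ℂ) : ℂ :=
  ∑ i : Fin 4, ∑ j : Fin 4, Bmat i j * x i * (starRingEnd ℂ) (y j)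

/-- The real bilinear form `b(x,y) = (2/3)·Re⟨x,y⟩`. -/
def bB (x y : Fin 4 → ℂ) : ℝ := (2/3) * (hermB x y).re

/-- The ℤ-basis `e₁, ωe₁, e₂, ωe₂, e₃, ωe₃, e₄, ωe₄` of the underlying ℤ-module of `ℰ⁴`. -/
def basE8 : Fin 8 → (Fin 4 → ℂ) := fun k =>
  if k.val % 2 = 0 then Pi.single (⟨k.val / 2, by have := k.isLt; omega⟩ : Fin 4) (1 : ℂ)
  else ω • (Pi.single (⟨k.val / 2, by have := k.isLt; omega⟩ : Fin 4) (1 : ℂ) : Fin 4 → ℂ)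

/-- The vector with Eisenstein coordinates `a i + b i * ω`. -/
def eisVec (a b : Fin 4 → ℤ) : Fin 4 → ℂ := fun i => a i + b i * ω

/-- The form `bB` in integer coordinates. -/
def intForm (a b c d : Fin 4 → ℤ) : ℤ :=
  ∑ i, (2 * a i * c i + 2 * b i * d i - a i * d i - b i * c i) +
    ∑ i : Fin 3, (a i.castSucc * d i.succ - b i.castSucc * c i.succ +
      b i.succ * c i.castSucc - a i.succ * d i.castSucc)

lemma ω_sq : ω ^ 2 = -1 - ω := by
  have h : Real.sqrt 3 * Real.sqrt 3 = 3 := Real.mul_self_sqrt (by norm_num)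
  apply Complex.ext
  · simp [ω, pow_two]
    linarith
  · simp [ω, pow_two]
    ring

lemma exists_int_of_mem_Eis {z : ℂ} (hz : z ∈ Eis) : ∃ a b : ℤ, z = a + b * ω := by
  induction hz using Subring.closure_induction with
  | mem x hx => exact ⟨0, 1, by simp_all⟩
  | zero => exact ⟨0, 0, by simp⟩
  | one => exact ⟨1, 0, by simp⟩
  | add x y _ _ hx hy =>
    obtain ⟨a, b, rfl⟩ := hx
    obtain ⟨c, d, rfl⟩ := hy
    exact ⟨a + c, b + d, by push_cast; ring⟩
  | neg x _ hx =>
    obtain ⟨a, b, rfl⟩ := hx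
    exact ⟨-a, -b, by push_cast; ring⟩
  | mul x y _ _ hx hy =>
    obtain ⟨a, b, rfl⟩ := hx
    obtain ⟨c, d, rfl⟩ := hy
    refine ⟨a * c - b * d, a * d + b * c - b * d, ?_⟩
    push_cast
    linear_combination (b * d : ℂ) * ω_sq

lemma exists_eq_eisVec {x : Fin 4 → ℂ} (hx : ∀ i, x i ∈ Eis) : ∃ a b, x = eisVec a b := by
  choose a b h using fun i => exists_int_of_mem_Eis (hx i)
  exact ⟨a, b, funext h⟩

lemma bB_eisVec (a b c d : Fin 4 → ℤ) :
    bB (eisVec a b) (eisVec c d) = (intForm a b c d : ℝ) := by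
  have h : Real.sqrt 3 ^ 2 = 3 := Real.sq_sqrt (by norm_num)
  simp [bB, hermB, Bmat, intForm, eisVec, ω, θ, Fin.sum_univ_succ]
  ring_nf
  rw [h]
  ring

lemma even_intForm_self (a b : Fin 4 → ℤ) : Even (intForm a b a b) := by
  simp only [intForm]
  refine Even.add (Finset.even_sum _ fun i _ => ?_) (Finset.even_sum _ fun i _ => ?_)
  · exact ⟨a i * a i + b i * b i - a i * b i, by ring⟩
  · exact ⟨a i.castSucc * b i.succ - b i.castSucc * a i.succ, by ring⟩

/-- The norm form of `ℤ[ω]` is nonnegative. -/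
lemma sq_sub_mul_add_sq_nonneg (p q : ℝ) : 0 ≤ p ^ 2 - p * q + q ^ 2 := by
  nlinarith [sq_nonneg (2 * p - q), sq_nonneg q]

lemma eq_zero_of_sq_sub_mul_add_sq {p q : ℝ} (h : p ^ 2 - p * q + q ^ 2 ≤ 0) :
    p = 0 ∧ q = 0 := by
  constructor
  · exact pow_eq_zero_iff (two_ne_zero) |>.1
      (by nlinarith [sq_nonneg (2 * q - p), sq_nonneg p] : p ^ 2 = 0)
  · exact pow_eq_zero_iff (two_ne_zero) |>.1
      (by nlinarith [sq_nonneg (2 * p - q), sq_nonneg q] : q ^ 2 = 0)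

/-- Completing the square in `intForm` over `ℚ(ω)`. -/
lemma intForm_self_eq (a b : Fin 4 → ℤ) :
    let N : ℝ → ℝ → ℝ := fun p q => p ^ 2 - p * q + q ^ 2
    (intForm a b a b : ℝ) =
      2 * N (a 0 - (a 1 - 2 * b 1) / 3) (b 0 - (2 * a 1 - b 1) / 3) +
      4 / 3 * N (a 1 - (a 2 - 2 * b 2) / 2) (b 1 - (2 * a 2 - b 2) / 2) +
      N (a 2 - 2 * (a 3 - 2 * b 3) / 3) (b 2 - 2 * (2 * a 3 - b 3) / 3) +
      2 / 3 * N (a 3) (b 3) := by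
  simp [intForm, Fin.sum_univ_succ]
  ring

lemma intForm_self_pos {a b : Fin 4 → ℤ} (h : eisVec a b ≠ 0) :
    (0 : ℝ) < intForm a b a b := by
  by_contra! hle
  rw [intForm_self_eq] at hle
  have h₀ := sq_sub_mul_add_sq_nonneg
    (a 0 - (a 1 - 2 * b 1) / 3) (b 0 - (2 * a 1 - b 1) / 3)
  have h₁ := sq_sub_mul_add_sq_nonneg
    (a 1 - (a 2 - 2 * b 2) / 2) (b 1 - (2 * a 2 - b 2) / 2)
  have h₂ := sq_sub_mul_add_sq_nonneg
    (a 2 - 2 * (a 3 - 2 * b 3) / 3) (b 2 - 2 * (2 * a 3 - b 3) / 3)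
  have h₃ := sq_sub_mul_add_sq_nonneg (a 3) (b 3)
  obtain ⟨ha3, hb3⟩ := eq_zero_of_sq_sub_mul_add_sq (p := a 3) (q := b 3) (by linarith)
  obtain ⟨ha2, hb2⟩ := eq_zero_of_sq_sub_mul_add_sq
    (p := a 2 - 2 * (a 3 - 2 * b 3) / 3) (q := b 2 - 2 * (2 * a 3 - b 3) / 3) (by linarith)
  obtain ⟨ha1, hb1⟩ := eq_zero_of_sq_sub_mul_add_sq
    (p := a 1 - (a 2 - 2 * b 2) / 2) (q := b 1 - (2 * a 2 - b 2) / 2) (by linarith)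
  obtain ⟨ha0, hb0⟩ := eq_zero_of_sq_sub_mul_add_sq
    (p := a 0 - (a 1 - 2 * b 1) / 3) (q := b 0 - (2 * a 1 - b 1) / 3) (by linarith)
  apply h
  simp only [ha3, hb3, mul_zero, sub_zero, zero_div] at ha2 hb2
  simp only [ha2, hb2, mul_zero, sub_zero, zero_div] at ha1 hb1
  simp only [ha1, hb1, mul_zero, sub_zero, zero_div] at ha0 hb0
  norm_cast at *
  funext i
  fin_cases i <;> simp [eisVec, *]

/-- The Gram matrix of the form in the basis `basE8`, with integer entries. -/
def gramE8 : Matrix (Fin 8) (Fin 8) ℤ := Matrix.of fun k l =>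
  intForm (fun i => if k.val = 2 * i.val then 1 else 0)
    (fun i => if k.val = 2 * i.val + 1 then 1 else 0)
    (fun i => if l.val = 2 * i.val then 1 else 0)
    (fun i => if l.val = 2 * i.val + 1 then 1 else 0)

lemma basE8_eq_eisVec (k : Fin 8) :
    basE8 k = eisVec (fun i => if k.val = 2 * i.val then 1 else 0)
      (fun i => if k.val = 2 * i.val + 1 then 1 else 0) := by
  funext i
  fin_cases k <;> fin_cases i <;> simp [basE8, eisVec]

/-- The lower triangular factor of `gramE8`. -/
def gramLower : Matrix (Fin 8) (Fin 8) ℚ :=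
  !![1, 0, 0, 0, 0, 0, 0, 0;
     -1/2, 1, 0, 0, 0, 0, 0, 0;
     0, -2/3, 1, 0, 0, 0, 0, 0;
     1/2, 1/3, -1/2, 1, 0, 0, 0, 0;
     0, 0, 0, -1, 1, 0, 0, 0;
     0, 0, 3/4, 1/2, -1/2, 1, 0, 0;
     0, 0, 0, 0, 0, -4/3, 1, 0;
     0, 0, 0, 0, 1, 2/3, -1/2, 1]

/-- The upper triangular factor of `gramE8`. -/
def gramUpper : Matrix (Fin 8) (Fin 8) ℚ :=
  !![2, -1, 0, 1, 0, 0, 0, 0;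
     0, 3/2, -1, 1/2, 0, 0, 0, 0;
     0, 0, 4/3, -2/3, 0, 1, 0, 0;
     0, 0, 0, 1, -1, 1/2, 0, 0;
     0, 0, 0, 0, 1, -1/2, 0, 1;
     0, 0, 0, 0, 0, 3/4, -1, 1/2;
     0, 0, 0, 0, 0, 0, 2/3, -1/3;
     0, 0, 0, 0, 0, 0, 0, 1/2]

lemma gramE8_map_eq : gramE8.map (Int.castRingHom ℚ) = gramLower * gramUpper := by
  decide +kernel

lemma det_gramLower : gramLower.det = 1 := by
  rw [Matrix.det_of_isLowerTriangular _ (fun i j => (by decide +kernel :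
    ∀ p : Fin 8 × Fin 8, p.1 < p.2 → gramLower p.1 p.2 = 0) (i, j))]
  decide +kernel

lemma det_gramUpper : gramUpper.det = 1 := by
  rw [Matrix.det_of_isUpperTriangular (fun i j => (by decide +kernel :
    ∀ p : Fin 8 × Fin 8, p.2 < p.1 → gramUpper p.1 p.2 = 0) (i, j))]
  decide +kernel

lemma det_gramE8 : gramE8.det = 1 := by
  have h : (gramE8.map (Int.castRingHom ℚ)).det = 1 := by
    rw [gramE8_map_eq, Matrix.det_mul, det_gramLower, det_gramUpper, one_mul]
  rw [← RingHom.mapMatrix_apply, ← RingHom.map_det] at h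
  exact Int.cast_injective (α := ℚ) (h.trans Int.cast_one.symm)

/-- On the underlying rank-8 ℤ-module of `E₈^ℰ` (vectors with Eisenstein
coordinates), `b = (2/3)Re⟨·,·⟩` is ℤ-valued, even, positive definite, and its Gram
matrix with respect to the ℤ-basis `e₁, ωe₁, …, e₄, ωe₄` has determinant 1. -/
theorem stmt_4 :
    (∀ x y : Fin 4 → ℂ, (∀ i, x i ∈ Eis) → (∀ i, y i ∈ Eis) → ∃ n : ℤ, bB x y = (n : ℝ)) ∧
    (∀ x : Fin 4 → ℂ, (∀ i, x i ∈ Eis) → ∃ n : ℤ, bB x x = 2 * (n : ℝ)) ∧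
    (∀ x : Fin 4 → ℂ, (∀ i, x i ∈ Eis) → x ≠ 0 → 0 < bB x x) ∧
    (Matrix.of fun k l : Fin 8 => bB (basE8 k) (basE8 l)).det = 1 := by
  refine ⟨fun x y hx hy => ?_, fun x hx => ?_, fun x hx hne => ?_, ?_⟩
  · obtain ⟨a, b, rfl⟩ := exists_eq_eisVec hx
    obtain ⟨c, d, rfl⟩ := exists_eq_eisVec hy
    exact ⟨_, bB_eisVec a b c d⟩
  · obtain ⟨a, b, rfl⟩ := exists_eq_eisVec hx
    obtain ⟨n, hn⟩ := even_intForm_self a b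
    exact ⟨n, by rw [bB_eisVec, hn]; push_cast; ring⟩
  · obtain ⟨a, b, rfl⟩ := exists_eq_eisVec hx
    rw [bB_eisVec]
    exact intForm_self_pos hne
  · have h : (Matrix.of fun k l : Fin 8 => bB (basE8 k) (basE8 l)) =
        (Int.castRingHom ℝ).mapMatrix gramE8 := by
      ext k l
      simp only [Matrix.of_apply, basE8_eq_eisVec, bB_eisVec, RingHom.mapMatrix_apply,
        Matrix.map_apply, gramE8, Int.coe_castRingHom]
    rw [h, ← RingHom.map_det, det_gramE8, map_one]
end
end
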